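/- arXiv:1207.1831 — 4 statements merged into one kernel-verified Lean document; each statement's English description precedes it below -/
import Mathlib

section
/- For every d ≥ 1 and every ε ∈ (0,1) there exists a constant C = C(d, ε) > 0 such that for every finite metric space (P, dist) with |P| = n points and doubling dimension at most d, there exist a (1+ε)-spanner H for P and a rooted tree T with at most 2n vertices together with an assignment r of a point of P to each vertex of T, satisfying: (i) r restricted to the leaves of T is a bijection onto P; (ii) the points assigned to the internal vertices of T are pairwise distinct; (iii) for every pair p, q ∈ P there exist the leaf u of T with r(u) = p, the leaf w with r(w) = q, an ancestor u' of u and an ancestor w' of w in T, such that the sequence of points obtained by applying r to the vertices of the tree path ascending from u to u', followed by applying r to the vertices of the tree path descending from w' to w, is a path in H (every consecutive pair of points is an edge of H) of total weight at most (1+ε)·dist(p,q); and (iv) the maximum degree of H and the maximum degree of T are both at most C. -/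
open scoped BigOperators

namespace Stmt7

variable {P : Type} [MetricSpace P]

/-- `H` is a graph on `P`: a finite set of unordered pairs of *distinct* points. -/
def IsGraphOn (H : Finset (Sym2 P)) : Prop :=
  ∀ e ∈ H, ¬ e.IsDiag

open Classical in
/-- The degree of the point `p` in the graph `H`: the number of edges incident on `p`. -/
noncomputable def degree (H : Finset (Sym2 P)) (p : P) : ℕ :=
  (H.filter (fun e => p ∈ e)).card

/-- A metric space has doubling dimension at most `d` if every ball can be covered
by at most `2^d` balls of half its radius. -/
def DoublingDimLE (P : Type) [MetricSpace P] (d : ℕ) : Prop :=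
  ∀ (x : P) (r : ℝ), ∃ S : Finset P, S.card ≤ 2 ^ d ∧
    Metric.ball x r ⊆ ⋃ y ∈ S, Metric.ball y (r / 2)

/-- In a rooted tree on `Fin m` given by a parent function `par`, a vertex is a leaf
if no other vertex has it as a parent. -/
def IsLeaf {m : ℕ} (par : Fin m → Fin m) (v : Fin m) : Prop :=
  ∀ w, par w = v → w = v

/-- `par` describes a rooted tree: roots (fixed points of `par`) are unique, and
iterating the parent function from any vertex eventually reaches a root. -/
def IsRootedTree {m : ℕ} (par : Fin m → Fin m) : Prop :=
  (∀ v w, par v = v → par w = w → v = w) ∧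
    ∀ v, ∃ k : ℕ, par (par^[k] v) = par^[k] v

open Classical in
/-- The degree of a vertex in the rooted tree described by the parent function `par`:
the number of its children plus one for its parent edge (if it is not the root). -/
noncomputable def treeDeg {m : ℕ} (par : Fin m → Fin m) (v : Fin m) : ℕ :=
  (Finset.univ.filter fun w => par w = v ∧ w ≠ v).card + (if par v ≠ v then 1 else 0)

/-- The sequence of points obtained by applying `r` to the vertices of the tree path
ascending from `u` to its ancestor `par^[a] u`. -/
def ascendSeq {m : ℕ} (par : Fin m → Fin m) (r : Fin m → P) (u : Fin m) (a : ℕ) :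
    List P :=
  (List.range (a + 1)).map fun i => r (par^[i] u)

/-! ### Packing -/

/-- A `τ`-separated set inside a ball of radius `2 ^ j * (τ / 2)` of a space of doubling
dimension at most `d` has at most `(2 ^ d) ^ j` points. -/
lemma card_le_of_separated {d : ℕ} (hP : DoublingDimLE P d) {τ : ℝ} (j : ℕ) :
    ∀ (x : P) (F : Finset P), (∀ y ∈ F, ∀ z ∈ F, y ≠ z → τ ≤ dist y z) →
      (∀ y ∈ F, dist y x < 2 ^ j * (τ / 2)) → F.card ≤ (2 ^ d) ^ j := by
  classical
  induction j with
  | zero =>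
    intro x F hsep hF
    rw [pow_zero, Finset.card_le_one]
    intro y hy z hz
    by_contra hyz
    have h1 := hF y hy
    have h2 := hF z hz
    have h3 := hsep y hy z hz hyz
    have h4 := dist_triangle_right y z x
    linarith
  | succ j ih =>
    intro x F hsep hF
    obtain ⟨T, hTcard, hT⟩ := hP x (2 ^ (j + 1) * (τ / 2))
    have hsub : F ⊆ T.biUnion fun y => F.filter fun z => dist z y < 2 ^ j * (τ / 2) := by
      intro z hz
      obtain ⟨y, hy, hzy⟩ := Set.mem_iUnion₂.1 (hT (Metric.mem_ball.2 (hF z hz)))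
      refine Finset.mem_biUnion.2 ⟨y, hy, Finset.mem_filter.2 ⟨hz, ?_⟩⟩
      have := Metric.mem_ball.1 hzy
      rw [pow_succ] at this
      linarith
    calc F.card ≤ _ := Finset.card_le_card hsub
      _ ≤ T.card * (2 ^ d) ^ j := by
          refine Finset.card_biUnion_le_card_mul _ _ _ fun y _ => ih y _ ?_ ?_
          · intro a ha b hb
            exact hsep a (Finset.mem_filter.1 ha).1 b (Finset.mem_filter.1 hb).1
          · intro a ha
            exact (Finset.mem_filter.1 ha).2
      _ ≤ 2 ^ d * (2 ^ d) ^ j := Nat.mul_le_mul_right _ hTcard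
      _ = (2 ^ d) ^ (j + 1) := by ring

/-! ### Scales -/

/-- `t` assigns a positive scale to each point: points are separated by the smaller of their
scales, each point other than the root `ρ` has a point of at least twice its scale nearby, and the
scale of `ρ` exceeds all others by the factor `S`. -/
structure IsScale (t : P → ℝ) (ρ : P) (S : ℝ) : Prop where
  pos : ∀ x, 0 < t x
  sep : ∀ x y, x ≠ y → min (t x) (t y) ≤ dist x y
  cov : ∀ x, x ≠ ρ → ∃ y, 2 * t x ≤ t y ∧ dist x y ≤ 2 * t x
  top : ∀ x, x ≠ ρ → S * t x ≤ t ρ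

/-- Points of comparable scales within a proportional distance of a common centre are boundedly
many. -/
lemma IsScale.card_le {d : ℕ} (hP : DoublingDimLE P d) {t : P → ℝ} {ρ : P} {S : ℝ}
    (ht : IsScale t ρ S) {A B : ℝ} {j : ℕ} (hA : 0 ≤ A) (hj : 2 * (A * B) < 2 ^ j)
    (x : P) (F : Finset P) (hx : ∀ z ∈ F, dist z x ≤ A * t z)
    (hw : ∀ z ∈ F, ∀ z' ∈ F, t z' ≤ B * t z) : F.card ≤ (2 ^ d) ^ j := by
  rcases F.eq_empty_or_nonempty with rfl | hne
  · simp
  obtain ⟨z₀, hz₀, hmin⟩ := Finset.exists_min_image F t hne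
  refine card_le_of_separated hP (τ := t z₀) j x F ?_ ?_
  · intro y hy z hz hyz
    exact (le_min (hmin y hy) (hmin z hz)).trans (ht.sep y z hyz)
  · intro z hz
    have h1 := hx z hz
    have h2 := mul_le_mul_of_nonneg_left (hw z₀ hz₀ z hz) hA
    have h3 := mul_lt_mul_of_pos_right hj (ht.pos z₀)
    linarith

/-- A finite set has a maximal `τ`-separated subset. -/
lemma exists_maximal_separated [Finite P] (A : Set P) (τ : ℝ) :
    ∃ T ⊆ A, (∀ x ∈ T, ∀ y ∈ T, x ≠ y → τ ≤ dist x y) ∧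
      ∀ x ∈ A, x ∉ T → ∃ y ∈ T, dist x y < τ := by
  obtain ⟨T, hT⟩ := (Set.toFinite
    {T : Set P | T ⊆ A ∧ ∀ x ∈ T, ∀ y ∈ T, x ≠ y → τ ≤ dist x y}).exists_maximal
    ⟨∅, by simp⟩
  refine ⟨T, hT.prop.1, hT.prop.2, fun x hxA hxT => ?_⟩
  by_contra! hx
  refine hxT (hT.le_of_ge (y := insert x T) ⟨Set.insert_subset hxA hT.prop.1, ?_⟩
    (Set.subset_insert x T) (Set.mem_insert x T))
  rintro y (rfl | hy) z (rfl | hz) hyz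
  · exact absurd rfl hyz
  · exact hx z hz
  · rw [dist_comm]; exact hx y hy
  · exact hT.prop.2 y hy z hz hyz

/-- Nested nets up to level `k`, encoded by the highest level of each point. -/
lemma exists_levels [Finite P] {δ : ℝ} (hδ : ∀ x y : P, x ≠ y → δ ≤ dist x y) (k : ℕ) :
    ∃ K : P → ℕ, (∀ x, K x ≤ k) ∧ (∀ x y, x ≠ y → δ * 2 ^ min (K x) (K y) ≤ dist x y) ∧
      ∀ x, K x < k → ∃ y, K x < K y ∧ dist x y ≤ δ * 2 ^ (K x + 1) := by
  classical
  induction k with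
  | zero => exact ⟨fun _ => 0, by simp, by simpa using hδ, by simp⟩
  | succ k ih =>
    obtain ⟨K, hK, hsep, hcov⟩ := ih
    obtain ⟨T, hTA, hTsep, hTmax⟩ := exists_maximal_separated {x | K x = k} (δ * 2 ^ (k + 1))
    have hTK : ∀ x ∈ T, K x = k := hTA
    refine ⟨fun x => if x ∈ T then k + 1 else K x, ?_, ?_, ?_⟩
    · intro x
      dsimp only
      split_ifs
      · exact le_rfl
      · exact (hK x).trans k.le_succ
    · intro x y hxy
      have h := hsep x y hxy
      dsimp only
      split_ifs with hx hy hy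
      · simpa using hTsep x hx y hy hxy
      · rw [hTK x hx, min_eq_right (hK y)] at h
        rwa [min_eq_right ((hK y).trans k.le_succ)]
      · rw [hTK y hy, min_eq_left (hK x)] at h
        rwa [min_eq_left ((hK x).trans k.le_succ)]
      · exact h
    · intro x hx
      dsimp only at hx ⊢
      split_ifs at hx ⊢ with hxT
      · exact absurd hx (lt_irrefl _)
      · rcases (hK x).lt_or_eq with hlt | heq
        · obtain ⟨y, hy, hd⟩ := hcov x hlt
          refine ⟨y, ?_, hd⟩
          split_ifs
          · exact hx
          · exact hy
        · obtain ⟨y, hy, hd⟩ := hTmax x heq hxT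
          exact ⟨y, by rw [if_pos hy]; exact hx, by rw [heq]; exact hd.le⟩

lemma exists_isScale [Finite P] [Nonempty P] {S : ℝ} (hS : 1 < S) :
    ∃ (t : P → ℝ) (ρ : P), IsScale t ρ S := by
  classical
  obtain ⟨δ, hδ0, hδ⟩ : ∃ δ : ℝ, 0 < δ ∧ ∀ x y : P, x ≠ y → δ ≤ dist x y := by
    obtain ⟨p, hp⟩ := Finite.exists_min
      fun p : P × P => if p.1 = p.2 then 1 else dist p.1 p.2
    refine ⟨_, ?_, fun x y hxy => (hp (x, y)).trans_eq (if_neg hxy)⟩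
    split_ifs with h
    · exact one_pos
    · exact dist_pos.2 h
  obtain ⟨p, hp⟩ := Finite.exists_max fun p : P × P => dist p.1 p.2
  obtain ⟨k, hk⟩ := pow_unbounded_of_one_lt ((S * (dist p.1 p.2)) / δ) (one_lt_two (α := ℝ))
  rw [div_lt_iff₀ hδ0, mul_comm (2 ^ k)] at hk
  obtain ⟨K, hK, hsep, hcov⟩ := exists_levels hδ k
  obtain ⟨ρ, hρ⟩ := Finite.exists_max K
  have hρk : K ρ = k := by
    refine (hK ρ).eq_of_not_lt fun hlt => ?_
    obtain ⟨y, hy, -⟩ := hcov ρ hlt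
    exact absurd (hρ y) hy.not_ge
  have hdiam : ∀ x, x ≠ ρ → δ * 2 ^ K x ≤ dist p.1 p.2 := by
    intro x hx
    have := hsep x ρ hx
    rw [hρk, min_eq_left (hK x)] at this
    exact this.trans (hp (x, ρ))
  have htop : ∀ x, x ≠ ρ → S * (δ * 2 ^ K x) ≤ δ * 2 ^ K ρ := by
    intro x hx
    have := mul_le_mul_of_nonneg_left (hdiam x hx) (zero_le_one.trans hS.le)
    rw [hρk]
    linarith
  refine ⟨fun x => δ * 2 ^ K x, ρ, fun x => by positivity, ?_, ?_, htop⟩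
  · intro x y hxy
    refine le_trans ?_ (hsep x y hxy)
    rcases le_total (K x) (K y) with h | h
    · rw [min_eq_left h]; exact min_le_left _ _
    · rw [min_eq_right h]; exact min_le_right _ _
  · intro x hx
    have hlt : K x < k := by
      refine (hK x).lt_of_ne fun heq => ?_
      have h1 := htop x hx
      rw [hρk, heq] at h1
      have h2 : 0 < δ * 2 ^ k := by positivity
      nlinarith
    obtain ⟨y, hy, hd⟩ := hcov x hlt
    refine ⟨y, ?_, ?_⟩
    · have : (2 : ℝ) ^ (K x + 1) ≤ 2 ^ K y := pow_le_pow_right₀ one_le_two hy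
      have := mul_le_mul_of_nonneg_left this hδ0.le
      rw [pow_succ] at this
      linarith
    · rw [pow_succ] at hd
      linarith

/-! ### Parents in the net hierarchy -/

/-- `g` sends each point other than `ρ` to a nearby point of larger scale, giving priority to
points whose scale is larger by the factor `S`. -/
structure IsNetParent (t : P → ℝ) (ρ : P) (S R : ℝ) (g : P → P) : Prop where
  grow : ∀ z, z ≠ ρ → 2 * t z ≤ t (g z)
  near : ∀ z, z ≠ ρ → dist z (g z) ≤ R * t z
  short : ∀ z, z ≠ ρ → t (g z) < S * t z → dist z (g z) ≤ 2 * t z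
  long : ∀ z, z ≠ ρ → ∀ x, S * t z ≤ t x → dist z x ≤ R * t z → g z = x

lemma IsScale.exists_isNetParent {t : P → ℝ} {ρ : P} {S R : ℝ} (ht : IsScale t ρ S)
    (hR : 2 ≤ R) (hS : 2 * R < S) : ∃ g, IsNetParent t ρ S R g := by
  have key : ∀ z, ∃ x, z ≠ ρ → 2 * t z ≤ t x ∧ dist z x ≤ R * t z ∧
      (t x < S * t z → dist z x ≤ 2 * t z) ∧
      ∀ y, S * t z ≤ t y → dist z y ≤ R * t z → x = y := by
    intro z
    have hz := ht.pos z
    by_cases hx : ∃ x, S * t z ≤ t x ∧ dist z x ≤ R * t z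
    · obtain ⟨x, hx, hd⟩ := hx
      refine ⟨x, fun _ => ⟨by nlinarith, hd, fun h => absurd hx h.not_ge, fun y hy hdy => ?_⟩⟩
      by_contra hxy
      have h1 := (le_min hx hy).trans (ht.sep x y hxy)
      have h2 := dist_triangle_left x y z
      nlinarith
    · push Not at hx
      by_cases hzρ : z = ρ
      · exact ⟨z, fun h => absurd hzρ h⟩
      · obtain ⟨y, hy, hd⟩ := ht.cov z hzρ
        exact ⟨y, fun _ => ⟨hy, by nlinarith, fun _ => hd,
          fun w hw hdw => absurd hdw (hx w hw).not_ge⟩⟩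
  choose g hg using key
  exact ⟨g, fun z hz => (hg z hz).1, fun z hz => (hg z hz).2.1, fun z hz => (hg z hz).2.2.1,
    fun z hz => (hg z hz).2.2.2⟩

/-! ### Bounded-degree tree -/

/-- `π` routes each point `z` to its net parent `g z`: directly when the scales are comparable,
and otherwise through the children of `g z` of much smaller scale than `z`, if there are any. -/
structure IsRouting (t : P → ℝ) (ρ : P) (S : ℝ) (g π : P → P) : Prop where
  root : π ρ = ρ
  short : ∀ z, z ≠ ρ → t (g z) < S * t z → π z = g z
  long : ∀ z, z ≠ ρ → S * t z ≤ t (g z) →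
    (π z = g z ∧ ∀ y, y ≠ ρ → g y = g z → t z < S * t y) ∨
    (π z ≠ ρ ∧ g (π z) = g z ∧ S * t (π z) ≤ t z ∧
      ∀ y, y ≠ ρ → g y = g z → S * t y ≤ t z → t y ≤ t (π z))

lemma exists_isRouting {Q : Type} [Finite Q] (t : Q → ℝ) (ρ : Q) (S : ℝ) (g : Q → Q) :
    ∃ π, IsRouting t ρ S g π := by
  have key : ∀ z, ∃ x, (z = ρ → x = ρ) ∧ (z ≠ ρ → t (g z) < S * t z → x = g z) ∧
      (z ≠ ρ → S * t z ≤ t (g z) →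
        (x = g z ∧ ∀ y, y ≠ ρ → g y = g z → t z < S * t y) ∨
        (x ≠ ρ ∧ g x = g z ∧ S * t x ≤ t z ∧
          ∀ y, y ≠ ρ → g y = g z → S * t y ≤ t z → t y ≤ t x)) := by
    intro z
    by_cases hz : z = ρ
    · exact ⟨ρ, by simp, fun h => absurd hz h, fun h => absurd hz h⟩
    by_cases hs : t (g z) < S * t z
    · exact ⟨g z, fun h => absurd h hz, fun _ _ => rfl, fun _ h => absurd h hs.not_ge⟩
    by_cases hne : {y | y ≠ ρ ∧ g y = g z ∧ S * t y ≤ t z}.Nonempty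
    · obtain ⟨x, ⟨hxρ, hgx, htx⟩, hmax⟩ := Set.exists_max_image _ t (Set.toFinite _) hne
      exact ⟨x, fun h => absurd h hz, fun _ h => absurd h hs, fun _ _ =>
        Or.inr ⟨hxρ, hgx, htx, fun y hy hgy hty => hmax y ⟨hy, hgy, hty⟩⟩⟩
    · refine ⟨g z, fun h => absurd h hz, fun _ _ => rfl, fun _ _ => Or.inl ⟨rfl, ?_⟩⟩
      intro y hy hgy
      by_contra! hty
      exact hne ⟨y, hy, hgy, hty⟩
  choose π hπ using key
  exact ⟨π, (hπ ρ).1 rfl, fun z => (hπ z).2.1, fun z => (hπ z).2.2⟩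

open Classical in
/-- The fibres of a routing are boundedly large. -/
lemma IsRouting.card_fiber_le [Fintype P] {d : ℕ} (hP : DoublingDimLE P d) {t : P → ℝ} {ρ : P}
    {S R : ℝ} {g π : P → P} (ht : IsScale t ρ S) (hg : IsNetParent t ρ S R g)
    (hπ : IsRouting t ρ S g π) (hS : 1 < S) (hR : 0 ≤ R) {j : ℕ} (hj : 2 * (R * S) < 2 ^ j)
    (y : P) : (Finset.univ.filter fun z => z ≠ ρ ∧ π z = y).card ≤ 3 * (2 ^ d) ^ j := by
  let direct := Finset.univ.filter fun z => z ≠ ρ ∧ t (g z) < S * t z ∧ g z = y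
  let last := Finset.univ.filter fun z =>
    z ≠ ρ ∧ g z = y ∧ ∀ y', y' ≠ ρ → g y' = g z → t z < S * t y'
  let hop := Finset.univ.filter fun z => z ≠ ρ ∧ g z = g y ∧ S * t y ≤ t z ∧
    ∀ y', y' ≠ ρ → g y' = g z → S * t y' ≤ t z → t y' ≤ t y
  have hsub : (Finset.univ.filter fun z => z ≠ ρ ∧ π z = y) ⊆ direct ∪ (last ∪ hop) := by
    intro z hz
    obtain ⟨hzρ, rfl⟩ : z ≠ ρ ∧ π z = y := by simpa using hz
    simp only [direct, last, hop, Finset.mem_union, Finset.mem_filter, Finset.mem_univ, true_and]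
    rcases lt_or_ge (t (g z)) (S * t z) with hs | hl
    · exact Or.inl ⟨hzρ, hs, (hπ.short z hzρ hs).symm⟩
    · rcases hπ.long z hzρ hl with ⟨h1, h2⟩ | ⟨-, h2, h3, h4⟩
      · exact Or.inr (Or.inl ⟨hzρ, h1.symm, h2⟩)
      · exact Or.inr (Or.inr ⟨hzρ, h2.symm, h3, h4⟩)
  have hdirect : direct.card ≤ (2 ^ d) ^ j := by
    refine ht.card_le hP hR hj y direct ?_ ?_
    · intro z hz
      obtain ⟨hzρ, -, rfl⟩ := (Finset.mem_filter.1 hz).2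
      exact hg.near z hzρ
    · intro z hz z' hz'
      obtain ⟨-, h, hz⟩ := (Finset.mem_filter.1 hz).2
      obtain ⟨hzρ', -, hz'⟩ := (Finset.mem_filter.1 hz').2
      have h1 := hg.grow z' hzρ'
      have h2 := ht.pos z'
      rw [hz'] at h1
      rw [hz] at h
      linarith
  have hlast : last.card ≤ (2 ^ d) ^ j := by
    refine ht.card_le hP hR hj y last ?_ ?_
    · intro z hz
      obtain ⟨hzρ, rfl, -⟩ := (Finset.mem_filter.1 hz).2
      exact hg.near z hzρ
    · intro z hz z' hz'
      obtain ⟨hzρ, hz, -⟩ := (Finset.mem_filter.1 hz).2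
      obtain ⟨-, hz', h⟩ := (Finset.mem_filter.1 hz').2
      exact (h z hzρ (hz.trans hz'.symm)).le
  have hhop : hop.card ≤ (2 ^ d) ^ j := by
    refine ht.card_le hP hR hj (g y) hop ?_ ?_
    · intro z hz
      obtain ⟨hzρ, hgz, -⟩ := (Finset.mem_filter.1 hz).2
      rw [← hgz]
      exact hg.near z hzρ
    · intro z hz z' hz'
      obtain ⟨hzρ, hz, hyz, -⟩ := (Finset.mem_filter.1 hz).2
      obtain ⟨-, hz', -, h⟩ := (Finset.mem_filter.1 hz').2
      by_contra! hlt
      have h1 := h z hzρ (hz.trans hz'.symm) hlt.le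
      have h2 := ht.pos y
      nlinarith
  have h1 := Finset.card_le_card hsub
  have h2 := Finset.card_union_le direct (last ∪ hop)
  have h3 := Finset.card_union_le last hop
  omega

/-! ### Ascending paths -/

/-- `Reach π ρ p x W`: iterating `π` from `p`, without moving on from `ρ`, leads to `x` along a
path of weight `W`. -/
inductive Reach (π : P → P) (ρ p : P) : P → ℝ → Prop
  | refl : Reach π ρ p p 0
  | step {x : P} {W : ℝ} : Reach π ρ p x W → x ≠ ρ → Reach π ρ p (π x) (W + dist x (π x))

lemma Reach.trans {π : P → P} {ρ p x y : P} {W W' : ℝ} (h : Reach π ρ p x W)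
    (h' : Reach π ρ x y W') : Reach π ρ p y (W + W') := by
  induction h' with
  | refl => simpa using h
  | step _ hx ih => rw [← add_assoc]; exact ih.step hx

lemma Reach.dist_le {π : P → P} {ρ p x : P} {W : ℝ} (h : Reach π ρ p x W) : dist p x ≤ W := by
  induction h with
  | refl => simp
  | step _ _ ih => exact (dist_triangle _ _ _).trans (by gcongr)

lemma Reach.exists_iterate {π : P → P} {ρ p x : P} {W : ℝ} (h : Reach π ρ p x W) :
    ∃ k, π^[k] p = x := by
  induction h with
  | refl => exact ⟨0, rfl⟩
  | step _ _ ih =>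
    obtain ⟨k, rfl⟩ := ih
    exact ⟨k + 1, Function.iterate_succ_apply' π k p⟩

lemma Reach.exists_last_step {π : P → P} {ρ p x : P} {W : ℝ} (h : Reach π ρ p x W)
    (hpx : p ≠ x) : ∃ y W', Reach π ρ p y W' ∧ y ≠ ρ ∧ π y = x ∧ W' + dist y x = W := by
  cases h with
  | refl => exact absurd rfl hpx
  | step h hy => exact ⟨_, _, h, hy, rfl, rfl⟩

/-- A routing leads every point to its net parent almost without detour. -/
lemma IsRouting.reach_parent [Finite P] {t : P → ℝ} {ρ : P} {S R η : ℝ} {g π : P → P}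
    (ht : IsScale t ρ S) (hg : IsNetParent t ρ S R g) (hπ : IsRouting t ρ S g π)
    (hS : 1 < S) (hη : 0 ≤ η) (hηS : 2 * R + η ≤ η * S) (z : P) (hz : z ≠ ρ) :
    ∃ ℓ, Reach π ρ z (g z) ℓ ∧ ℓ ≤ dist z (g z) + η * t z ∧
      (t (g z) < S * t z → ℓ ≤ 2 * t z) := by
  have direct : ∀ z, z ≠ ρ → π z = g z → ∃ ℓ, Reach π ρ z (g z) ℓ ∧
      ℓ ≤ dist z (g z) + η * t z ∧ (t (g z) < S * t z → ℓ ≤ 2 * t z) := by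
    intro z hz h
    have hr := (Reach.refl (π := π) (ρ := ρ) (p := z)).step hz
    rw [h, zero_add] at hr
    exact ⟨_, hr, le_add_of_nonneg_right (mul_nonneg hη (ht.pos z).le), hg.short z hz⟩
  obtain ⟨n, hn⟩ : ∃ n, n = {y | t y < t z}.ncard := ⟨_, rfl⟩
  induction n using Nat.strong_induction_on generalizing z with
  | _ n ih =>
    rcases lt_or_ge (t (g z)) (S * t z) with hs | hl
    · exact direct z hz (hπ.short z hz hs)
    rcases hπ.long z hz hl with ⟨h1, -⟩ | ⟨hyρ, hgy, hty, -⟩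
    · exact direct z hz h1
    have hy0 := ht.pos (π z)
    have hlt : t (π z) < t z := by nlinarith
    obtain ⟨ℓ, hr, hℓ, -⟩ := ih _ (by
      rw [hn]
      exact Set.ncard_lt_ncard ⟨fun y hy => lt_trans hy hlt, fun h => lt_irrefl (t (π z)) (h hlt)⟩)
      (π z) hyρ rfl
    rw [hgy] at hr hℓ
    have hr' := ((Reach.refl (π := π) (ρ := ρ) (p := z)).step hz).trans hr
    refine ⟨_, hr', ?_, fun h => absurd hl h.not_ge⟩
    have h1 := hg.near (π z) hyρ
    rw [hgy] at h1
    have h2 := dist_triangle_right z (π z) (g z)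
    have h3 := mul_le_mul_of_nonneg_right hηS hy0.le
    have h4 := mul_le_mul_of_nonneg_left hty hη
    linarith

/-- From every point the root can be reached. -/
lemma IsRouting.reach_root [Finite P] {t : P → ℝ} {ρ : P} {S R η : ℝ} {g π : P → P}
    (ht : IsScale t ρ S) (hg : IsNetParent t ρ S R g) (hπ : IsRouting t ρ S g π) (hS : 1 < S)
    (hη : 0 ≤ η) (hηS : 2 * R + η ≤ η * S) (p : P) : ∃ W, Reach π ρ p ρ W := by
  obtain ⟨x, ⟨W, hW⟩, hmax⟩ := Set.exists_max_image {x | ∃ W, Reach π ρ p x W} t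
    (Set.toFinite _) ⟨p, 0, Reach.refl⟩
  by_cases hx : x = ρ
  · exact ⟨W, hx ▸ hW⟩
  obtain ⟨ℓ, hℓ, -⟩ := hπ.reach_parent ht hg hS hη hηS x hx
  have h1 := hmax (g x) ⟨_, hW.trans hℓ⟩
  have h2 := hg.grow x hx
  have h3 := ht.pos x
  linarith

/-- An ascent from `p` along net parents that stops at the last net ancestor `x` reachable within
the budget `B`; the walk from `x` to its net parent has weight `ℓ`. -/
structure IsAscent (t : P → ℝ) (ρ : P) (S η : ℝ) (g π : P → P) (B : ℝ) (p x : P) (W ℓ : ℝ) :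
    Prop where
  reach : Reach π ρ p x W
  le_budget : W ≤ B
  le_scale : W ≤ 2 * t x
  reach_parent : x ≠ ρ → Reach π ρ x (g x) ℓ
  length_le : x ≠ ρ → ℓ ≤ dist x (g x) + η * t x
  length_le_of_short : x ≠ ρ → t (g x) < S * t x → ℓ ≤ 2 * t x
  budget_lt : x ≠ ρ → B < W + ℓ

lemma IsRouting.exists_isAscent [Finite P] {t : P → ℝ} {ρ : P} {S R η : ℝ} {g π : P → P}
    (ht : IsScale t ρ S) (hg : IsNetParent t ρ S R g) (hπ : IsRouting t ρ S g π) (hS : 1 < S)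
    (hη : 0 ≤ η) (hηS : 2 * R + η ≤ η * S) (hRS : 2 + R + η ≤ 2 * S) {B : ℝ} (hB : 0 ≤ B)
    (p : P) : ∃ x W ℓ, IsAscent t ρ S η g π B p x W ℓ := by
  obtain ⟨x, ⟨W, hW, hWB, hWt⟩, hmax⟩ := Set.exists_max_image
    {x | ∃ W, Reach π ρ p x W ∧ W ≤ B ∧ W ≤ 2 * t x} t (Set.toFinite _)
    ⟨p, 0, Reach.refl, hB, by have := ht.pos p; linarith⟩
  by_cases hx : x = ρ
  · exact ⟨x, W, 0, hW, hWB, hWt, fun h => absurd hx h, fun h => absurd hx h,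
      fun h => absurd hx h, fun h => absurd hx h⟩
  obtain ⟨ℓ, hℓ, hle, hshort⟩ := hπ.reach_parent ht hg hS hη hηS x hx
  refine ⟨x, W, ℓ, hW, hWB, hWt, fun _ => hℓ, fun _ => hle, fun _ => hshort, fun _ => ?_⟩
  by_contra! hB'
  have h2 := hg.grow x hx
  have h3 := ht.pos x
  have h4 := hg.near x hx
  have h1 : t (g x) ≤ t x := by
    refine hmax (g x) ⟨_, hW.trans hℓ, hB', ?_⟩
    rcases lt_or_ge (t (g x)) (S * t x) with hs | hl
    · linarith [hshort hs]
    · nlinarith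
  linarith

lemma IsAscent.dist_le {t : P → ℝ} {ρ : P} {S η : ℝ} {g π : P → P} {β : ℝ}
    {p q x z : P} {W ℓ W' ℓ' : ℝ} (hx : IsAscent t ρ S η g π (β * dist p q) p x W ℓ)
    (hz : IsAscent t ρ S η g π (β * dist p q) q z W' ℓ') :
    dist x z ≤ (1 + 2 * β) * dist p q ∧ (1 - 2 * β) * dist p q ≤ dist x z := by
  have h1 := hx.reach.dist_le.trans hx.le_budget
  have h2 := hz.reach.dist_le.trans hz.le_budget
  have h3 := dist_triangle4 x p q z
  rw [dist_comm x p] at h3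
  have h4 := dist_triangle4_right p q x z
  constructor <;> linarith

lemma IsAscent.budget_lt_scale {t : P → ℝ} {ρ : P} {S R η B : ℝ} {g π : P → P}
    (hg : IsNetParent t ρ S R g) {p x : P} {W ℓ : ℝ} (hx : IsAscent t ρ S η g π B p x W ℓ)
    (hxρ : x ≠ ρ) : B < (2 + R + η) * t x := by
  have h1 := hx.budget_lt hxρ
  have h2 := hx.length_le hxρ
  have h3 := hg.near x hxρ
  have h4 := hx.le_scale
  linarith

/-- If the ascents from `p` and `q` end at points of incomparable scales, then the one of larger
scale is the net parent of the other one. -/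
lemma IsAscent.parent_eq {t : P → ℝ} {ρ : P} {S R R' η β : ℝ} {g π : P → P}
    (ht : IsScale t ρ S) (hg : IsNetParent t ρ S R g) (hβ : 0 < β) (hβ' : β ≤ 1 / 2)
    (hR : 8 ≤ β * R) (hR' : 2 * (2 + R + η) ≤ β * R') (hS : R + R' ≤ S)
    {p q x z : P} {W ℓ W' ℓ' : ℝ} (hx : IsAscent t ρ S η g π (β * dist p q) p x W ℓ)
    (hz : IsAscent t ρ S η g π (β * dist p q) q z W' ℓ') (hzρ : z ≠ ρ)
    (hxz : S * t z ≤ t x) : g z = x := by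
  have hd : dist z x ≤ 2 * dist p q := by
    have := (hx.dist_le hz).1
    rw [dist_comm z x]
    nlinarith [dist_nonneg (x := p) (y := q)]
  have hz0 := ht.pos z
  rcases lt_or_ge (t (g z)) (S * t z) with hs | hl
  · refine hg.long z hzρ x hxz ?_
    have h1 := hz.budget_lt hzρ
    have h2 := hz.length_le_of_short hzρ hs
    have h3 := hz.le_scale
    have h4 := mul_le_mul_of_nonneg_right hR hz0.le
    have h5 := mul_le_mul_of_nonneg_left hd hβ.le
    refine le_of_mul_le_mul_left (a := β) ?_ hβ
    linarith
  · by_contra hne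
    have h1 := (le_min hl hxz).trans (ht.sep _ _ hne)
    have h2 := hg.near z hzρ
    have h3 := dist_triangle_left (g z) x z
    have h4 := hz.budget_lt_scale hg hzρ
    have h5 := mul_le_mul_of_nonneg_right hR' hz0.le
    have h6 := mul_le_mul_of_nonneg_right hS hz0.le
    have h7 : 2 * dist p q < R' * t z := by
      refine lt_of_mul_lt_mul_left (a := β) ?_ hβ.le
      linarith
    linarith

/-- If the ascents from `p` and `q` end at points of incomparable scales, then the ascending path
from `q` leads straight to the end of the ascent from `p`. -/
lemma IsAscent.exists_path {t : P → ℝ} {ρ : P} {S R R' η β : ℝ} {g π : P → P}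
    (ht : IsScale t ρ S) (hg : IsNetParent t ρ S R g) (hη : 0 ≤ η) (hβ : 0 < β)
    (hβ' : β < 1 / 2) (hR : 8 ≤ β * R) (hR' : 2 * (2 + R + η) ≤ β * R') (hS : R + R' ≤ S)
    (hS1 : 1 < S) {p q x z : P} {W ℓ W' ℓ' : ℝ} (hpq : p ≠ q)
    (hx : IsAscent t ρ S η g π (β * dist p q) p x W ℓ)
    (hz : IsAscent t ρ S η g π (β * dist p q) q z W' ℓ') (hxz : S * t z ≤ t x) :
    ∃ y V, Reach π ρ q y V ∧ y ≠ ρ ∧ π y = x ∧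
      W + dist x y + V ≤ (1 + 4 * β + 2 * η) * dist p q := by
  obtain ⟨hd1, hd2⟩ := hx.dist_le hz
  have hD := dist_pos.2 hpq
  have hz0 := ht.pos z
  have hne : x ≠ z := by
    rintro rfl
    rw [dist_self] at hd2
    nlinarith
  have hzρ : z ≠ ρ := by
    rintro rfl
    have := ht.top x hne
    nlinarith [ht.pos x]
  have hgz := hx.parent_eq ht hg hβ hβ'.le hR hR' hS hz hzρ hxz
  have hr := hz.reach_parent hzρ
  rw [hgz] at hr
  obtain ⟨y, V, hV, hyρ, hy, hVℓ⟩ := hr.exists_last_step hne.symm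
  refine ⟨y, W' + V, hz.reach.trans hV, hyρ, hy, ?_⟩
  have h1 := hz.length_le hzρ
  have h2 := hx.le_budget
  have h3 := hz.le_budget
  have h4 : t z ≤ dist x z := le_trans (le_min (by nlinarith) le_rfl) (ht.sep x z hne)
  have h5 : t z ≤ 2 * dist p q := by nlinarith
  have h6 := mul_le_mul_of_nonneg_left h5 hη
  rw [hgz, dist_comm] at h1
  rw [dist_comm x y]
  linarith

/-! ### The spanner -/

/-- Lateral edges join distinct points whose scales are comparable to each other and to their
distance. -/
def Lateral (t : P → ℝ) (S R' : ℝ) (x z : P) : Prop :=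
  x ≠ z ∧ t x < S * t z ∧ t z < S * t x ∧ dist x z ≤ R' * t x ∧ dist x z ≤ R' * t z

open Classical in
/-- The graph consisting of the edges of `π` and the lateral edges. -/
noncomputable def spannerGraph [Fintype P] (t : P → ℝ) (ρ : P) (S R' : ℝ) (π : P → P) :
    Finset (Sym2 P) :=
  Finset.univ.filter fun e => ∃ x z, e = s(x, z) ∧ x ≠ z ∧ ((x ≠ ρ ∧ π x = z) ∨ Lateral t S R' x z)

lemma isGraphOn_spannerGraph [Fintype P] (t : P → ℝ) (ρ : P) (S R' : ℝ) (π : P → P) :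
    IsGraphOn (spannerGraph t ρ S R' π) := by
  classical
  intro e he
  obtain ⟨x, z, rfl, hxz, -⟩ := (Finset.mem_filter.1 he).2
  simpa using hxz

lemma adj_spannerGraph [Fintype P] {t : P → ℝ} {ρ : P} {S R' : ℝ} {π : P → P} {x z : P}
    (h : s(x, z) ∈ spannerGraph t ρ S R' π) :
    π x = z ∨ (z ≠ ρ ∧ π z = x) ∨ Lateral t S R' x z := by
  classical
  obtain ⟨x', z', he, -, h⟩ := (Finset.mem_filter.1 h).2
  rcases Sym2.eq_iff.1 he with ⟨rfl, rfl⟩ | ⟨rfl, rfl⟩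
  · exact h.imp (fun h => h.2) Or.inr
  · rcases h with h | ⟨h1, h2, h3, h4, h5⟩
    · exact Or.inr (Or.inl h)
    · rw [dist_comm] at h4 h5
      exact Or.inr (Or.inr ⟨h1.symm, h3, h2, h5, h4⟩)

lemma degree_le_card {Q : Type} {H : Finset (Sym2 Q)} {p : Q} {N : Finset Q}
    (h : ∀ z, s(p, z) ∈ H → z ∈ N) :
    degree H p ≤ N.card := by
  classical
  refine (Finset.card_le_card (t := N.image fun z => s(p, z)) ?_).trans Finset.card_image_le
  intro e he
  obtain ⟨heH, hpe⟩ := Finset.mem_filter.1 he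
  obtain ⟨z, rfl⟩ := Sym2.mem_iff_exists.1 hpe
  exact Finset.mem_image.2 ⟨z, h z heH, rfl⟩

lemma IsRouting.degree_spannerGraph_le [Fintype P] {d : ℕ} (hP : DoublingDimLE P d) {t : P → ℝ}
    {ρ : P} {S R R' : ℝ} {g π : P → P} (ht : IsScale t ρ S) (hg : IsNetParent t ρ S R g)
    (hπ : IsRouting t ρ S g π) (hS : 1 < S) (hR : 0 ≤ R) (hR' : 0 ≤ R') {j : ℕ}
    (hj : 2 * (R * S) < 2 ^ j) (hj' : 2 * (R' * (S * S)) < 2 ^ j) (p : P) :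
    degree (spannerGraph t ρ S R' π) p ≤ 1 + 4 * (2 ^ d) ^ j := by
  classical
  have h1 := hπ.card_fiber_le hP ht hg hS hR hj p
  have h2 : (Finset.univ.filter fun z => Lateral t S R' p z).card ≤ (2 ^ d) ^ j := by
    refine ht.card_le hP hR' hj' p _ ?_ ?_
    · intro z hz
      rw [dist_comm]
      exact (Finset.mem_filter.1 hz).2.2.2.2.2
    · intro z hz z' hz'
      have h3 := (Finset.mem_filter.1 hz).2.2.1
      have h4 := (Finset.mem_filter.1 hz').2.2.2.1
      nlinarith
  have h3 := degree_le_card (H := spannerGraph t ρ S R' π) (p := p)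
    (N := {π p} ∪ ((Finset.univ.filter fun z => z ≠ ρ ∧ π z = p) ∪
      Finset.univ.filter fun z => Lateral t S R' p z)) (fun z hz => by
        rcases adj_spannerGraph hz with h | h | h
        · simp [h]
        · simp [h]
        · simp [h])
  refine h3.trans ((Finset.card_union_le _ _).trans ?_)
  have h4 := Finset.card_union_le (Finset.univ.filter fun z => z ≠ ρ ∧ π z = p)
    (Finset.univ.filter fun z => Lateral t S R' p z)
  rw [Finset.card_singleton]
  omega

lemma exists_constants {ε : ℝ} (hε0 : 0 < ε) :
    ∃ β R R' S : ℝ, β = ε / 8 ∧ 0 < R ∧ 0 < R' ∧ 1 < S ∧ 8 ≤ β * R ∧ 2 * (2 + R + β) ≤ β * R' ∧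
      2 * R < S ∧ 2 * R + β ≤ β * S ∧ R + R' ≤ S ∧ 2 + R + β ≤ 2 * S := by
  obtain ⟨β, hβ⟩ : ∃ β, β = ε / 8 := ⟨_, rfl⟩
  have hβ0 : 0 < β := by linarith
  obtain ⟨R, hR⟩ : ∃ R, R = 8 / β := ⟨_, rfl⟩
  have hR0 : 0 < R := by rw [hR]; positivity
  obtain ⟨R', hR'⟩ : ∃ R', R' = 2 * (2 + R + β) / β := ⟨_, rfl⟩
  have hR'0 : 0 < R' := by rw [hR']; positivity
  have hQ0 : 0 < (2 * R + β) / β := by positivity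
  refine ⟨β, R, R', (2 * R + β) / β + 3 * R + R' + 3 + β, hβ, hR0, hR'0, by linarith, ?_, ?_,
    by linarith, ?_, by linarith, by linarith⟩
  · rw [hR]; field_simp; rfl
  · rw [hR']; field_simp; rfl
  · have h1 : β * ((2 * R + β) / β) = 2 * R + β := by field_simp
    have h2 : 0 ≤ β * (3 * R + R' + 3 + β) := by positivity
    linarith

/-- Any two points are joined by a short path that ascends, jumps along an edge of the spanner
graph, and descends. -/
lemma IsRouting.exists_path [Fintype P] {t : P → ℝ} {ρ : P} {S R R' β : ℝ} {g π : P → P}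
    (ht : IsScale t ρ S) (hg : IsNetParent t ρ S R g) (hπ : IsRouting t ρ S g π)
    (hβ : 0 < β) (hβ' : β < 1 / 2) (hS1 : 1 < S) (hR : 8 ≤ β * R)
    (hR' : 2 * (2 + R + β) ≤ β * R') (hβS : 2 * R + β ≤ β * S) (hRS : R + R' ≤ S)
    (hRS' : 2 + R + β ≤ 2 * S)
    (hedge : ∀ z, z ≠ ρ → s(z, π z) ∈ spannerGraph t ρ S R' π) {p q : P} (hpq : p ≠ q) :
    ∃ x z W V, Reach π ρ p x W ∧ Reach π ρ q z V ∧ s(x, z) ∈ spannerGraph t ρ S R' π ∧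
      W + dist x z + V ≤ (1 + 4 * β + 2 * β) * dist p q := by
  have hD := dist_pos.2 hpq
  have hB : 0 < β * dist p q := mul_pos hβ hD
  obtain ⟨x, W, ℓ, hx⟩ := hπ.exists_isAscent ht hg hS1 hβ.le hβS hRS' hB.le p
  obtain ⟨z, V, ℓ', hz⟩ := hπ.exists_isAscent ht hg hS1 hβ.le hβS hRS' hB.le q
  rcases le_or_gt (S * t z) (t x) with hxz | hxz
  · obtain ⟨y, V', hV, hyρ, rfl, hle⟩ :=
      hx.exists_path ht hg hβ.le hβ hβ' hR hR' hRS hS1 hpq hz hxz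
    refine ⟨π y, y, W, V', hx.reach, hV, ?_, hle⟩
    rw [Sym2.eq_swap]
    exact hedge y hyρ
  rcases le_or_gt (S * t x) (t z) with hzx | hzx
  · have hx' := hx
    have hz' := hz
    rw [dist_comm] at hx' hz'
    obtain ⟨y, V', hV, hyρ, rfl, hle⟩ :=
      hz'.exists_path ht hg hβ.le hβ hβ' hR hR' hRS hS1 hpq.symm hx' hzx
    refine ⟨y, π y, V', V, hV, hz.reach, hedge y hyρ, ?_⟩
    rw [dist_comm y, dist_comm p]
    linarith
  · obtain ⟨hd1, hd2⟩ := hx.dist_le hz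
    have hne : x ≠ z := by
      rintro rfl
      rw [dist_self] at hd2
      nlinarith
    have hxρ : x ≠ ρ := by
      rintro rfl
      exact absurd (ht.top z hne.symm) hxz.not_ge
    have hzρ : z ≠ ρ := by
      rintro rfl
      exact absurd (ht.top x hne) hzx.not_ge
    have hle : ∀ y, β * dist p q < (2 + R + β) * t y → dist x z ≤ R' * t y := by
      intro y hy
      have h1 := mul_le_mul_of_nonneg_right hR' (ht.pos y).le
      have h2 : dist x z ≤ 2 * dist p q := by nlinarith
      have h3 := mul_le_mul_of_nonneg_left h2 hβ.le
      refine le_of_mul_le_mul_left (a := β) ?_ hβ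
      linarith
    refine ⟨x, z, W, V, hx.reach, hz.reach, ?_, ?_⟩
    · classical
      exact Finset.mem_filter.2 ⟨Finset.mem_univ _, x, z, rfl, hne, Or.inr ⟨hne, hxz, hzx,
        hle x (hx.budget_lt_scale hg hxρ), hle z (hz.budget_lt_scale hg hzρ)⟩⟩
    · have h1 := hx.le_budget
      have h2 := hz.le_budget
      linarith

open Classical in
/-- The spanner and the underlying tree on `P`, with every tree vertex a point. -/
lemma exists_spanner (d : ℕ) {ε : ℝ} (hε0 : 0 < ε) (hε1 : ε < 1) :
    ∃ C : ℕ, ∀ (P : Type) [MetricSpace P] [Fintype P] [Nonempty P],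
      DoublingDimLE P d → ∃ (H : Finset (Sym2 P)) (π : P → P) (ρ : P), IsGraphOn H ∧
        π ρ = ρ ∧ (∀ p, ∃ k, π^[k] p = ρ) ∧ (∀ z, z ≠ ρ → s(z, π z) ∈ H) ∧
        (∀ p q, p ≠ q → ∃ x z W V, Reach π ρ p x W ∧ Reach π ρ q z V ∧ s(x, z) ∈ H ∧
          W + dist x z + V ≤ (1 + ε) * dist p q) ∧
        (∀ p, degree H p ≤ C) ∧ ∀ y, (Finset.univ.filter fun z => π z = y).card ≤ C := by
  obtain ⟨β, R, R', S, hβ, hR0, hR'0, hS1, hR, hR', hS2, hβS, hRS, hRS'⟩ := exists_constants hε0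
  have hβ0 : 0 < β := by linarith
  obtain ⟨j, hj⟩ := pow_unbounded_of_one_lt (2 * (R * S) + 2 * (R' * (S * S)))
    (one_lt_two (α := ℝ))
  have hS0 : 0 < S := zero_lt_one.trans hS1
  have hRSpos : 0 < R * S := by positivity
  have hRSpos' : 0 < R' * (S * S) := by positivity
  have hj1 : 2 * (R * S) < 2 ^ j := by linarith
  have hj2 : 2 * (R' * (S * S)) < 2 ^ j := by linarith
  refine ⟨1 + 4 * (2 ^ d) ^ j, ?_⟩
  intro P _ _ _ hP
  obtain ⟨t, ρ, ht⟩ := exists_isScale (P := P) hS1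
  obtain ⟨g, hg⟩ := ht.exists_isNetParent (R := R) (by nlinarith) hS2
  obtain ⟨π, hπ⟩ := exists_isRouting t ρ S g
  have hroot := hπ.reach_root ht hg hS1 hβ0.le hβS
  have hedge : ∀ z, z ≠ ρ → s(z, π z) ∈ spannerGraph t ρ S R' π := by
    intro z hz
    refine Finset.mem_filter.2 ⟨Finset.mem_univ _, z, π z, rfl, fun h => ?_, Or.inl ⟨hz, rfl⟩⟩
    obtain ⟨W, hW⟩ := hroot z
    obtain ⟨k, hk⟩ := hW.exists_iterate
    exact hz ((Function.iterate_fixed h.symm k).symm.trans hk)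
  refine ⟨spannerGraph t ρ S R' π, π, ρ, isGraphOn_spannerGraph _ _ _ _ _, hπ.root,
    fun p => (hroot p).elim fun W hW => hW.exists_iterate, hedge, ?_,
    hπ.degree_spannerGraph_le hP ht hg hS1 hR0.le hR'0.le hj1 hj2, ?_⟩
  · intro p q hpq
    obtain ⟨x, z, W, V, hx, hz, hxz, hle⟩ := hπ.exists_path ht hg hβ0 (by linarith) hS1 hR hR' hβS
      hRS hRS' hedge hpq
    refine ⟨x, z, W, V, hx, hz, hxz, hle.trans (mul_le_mul_of_nonneg_right ?_ dist_nonneg)⟩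
    linarith
  · intro y
    have h1 := hπ.card_fiber_le hP ht hg hS1 hR0.le hj1 y
    have hsub : (Finset.univ.filter fun z => π z = y) ⊆
        insert ρ (Finset.univ.filter fun z => z ≠ ρ ∧ π z = y) := by
      intro z hz
      by_cases h : z = ρ
      · simp [h]
      · simpa [h] using hz
    have h2 := (Finset.card_le_card hsub).trans (Finset.card_insert_le _ _)
    omega

/-! ### Paths as lists -/

/-- The total weight of a path given as a list of points. -/
def pathWeight (l : List P) : ℝ :=
  ((l.zip l.tail).map fun pr => dist pr.1 pr.2).sum

lemma pathWeight_append_cons_cons (l m : List P) (a b : P) :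
    pathWeight (l ++ a :: b :: m) = pathWeight (l ++ [a]) + dist a b + pathWeight (b :: m) := by
  induction l with
  | nil => simp [pathWeight]
  | cons c l ih =>
    cases l with
    | nil => simp [pathWeight, add_assoc]
    | cons e l =>
      simp only [pathWeight, List.cons_append, List.tail_cons, List.zip_cons_cons, List.map_cons,
        List.sum_cons] at ih ⊢
      linarith

lemma pathWeight_reverse (l : List P) : pathWeight l.reverse = pathWeight l := by
  induction l with
  | nil => rfl
  | cons a l ih =>
    cases l with
    | nil => rfl
    | cons b l =>
      have h := pathWeight_append_cons_cons l.reverse [] b a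
      have h' := pathWeight_append_cons_cons [] l a b
      rw [List.reverse_cons] at ih
      simp only [List.reverse_cons, List.append_assoc, List.cons_append, List.nil_append] at h h' ⊢
      rw [h, ih, h', dist_comm]
      simp [pathWeight, add_comm]

/-- The list of vertices visited by an ascending path. -/
lemma Reach.exists_list {π : P → P} {ρ p x : P} {W : ℝ} {H : Finset (Sym2 P)}
    (hH : ∀ z, z ≠ ρ → s(z, π z) ∈ H) (h : Reach π ρ p x W) :
    ∃ a l, (List.range (a + 1)).map (fun i => π^[i] p) = l ++ [x] ∧
      (l ++ [x]).IsChain (fun x y => s(x, y) ∈ H) ∧ pathWeight (l ++ [x]) = W := by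
  suffices ∃ a l, (List.range (a + 1)).map (fun i => π^[i] p) = l ++ [x] ∧ π^[a] p = x ∧
      (l ++ [x]).IsChain (fun x y => s(x, y) ∈ H) ∧ pathWeight (l ++ [x]) = W by
    obtain ⟨a, l, h1, -, h2⟩ := this
    exact ⟨a, l, h1, h2⟩
  induction h with
  | refl => exact ⟨0, [], by simp, rfl, by simp, by simp [pathWeight]⟩
  | @step x W _ hx ih =>
    obtain ⟨a, l, hl, hax, hc, hw⟩ := ih
    have hax' : π^[a + 1] p = π x := by rw [Function.iterate_succ_apply', hax]
    refine ⟨a + 1, l ++ [x], ?_, hax', ?_, ?_⟩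
    · rw [List.range_succ, List.map_append, hl, List.map_singleton, hax']
    · refine List.isChain_append.2 ⟨hc, by simp, ?_⟩
      simpa using hH x hx
    · rw [List.append_assoc, List.singleton_append, pathWeight_append_cons_cons, hw]
      simp [pathWeight]

/-- Ascending from `p`, jumping and descending to `q` as a list of points. -/
lemma Reach.exists_path_list {π : P → P} {ρ p q x z : P} {W V : ℝ} {H : Finset (Sym2 P)}
    (hH : ∀ z, z ≠ ρ → s(z, π z) ∈ H) (hx : Reach π ρ p x W) (hz : Reach π ρ q z V)
    (hxz : s(x, z) ∈ H) :
    ∃ a b, ((List.range (a + 1)).map (fun i => π^[i] p) ++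
        ((List.range (b + 1)).map fun i => π^[i] q).reverse).IsChain (fun x y => s(x, y) ∈ H) ∧
      pathWeight ((List.range (a + 1)).map (fun i => π^[i] p) ++
        ((List.range (b + 1)).map fun i => π^[i] q).reverse) = W + dist x z + V := by
  obtain ⟨a, l, hl, hlc, hlw⟩ := hx.exists_list hH
  obtain ⟨b, m, hm, hmc, hmw⟩ := hz.exists_list hH
  refine ⟨a, b, ?_, ?_⟩
  · rw [hl, hm]
    refine List.isChain_append.2 ⟨hlc, ?_, ?_⟩
    · rw [List.isChain_reverse]
      simpa only [Sym2.eq_swap] using hmc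
    · simpa using hxz
  · rw [hl, hm, ← hlw, ← hmw, ← pathWeight_reverse (m ++ [z])]
    simpa using pathWeight_append_cons_cons l m.reverse x z

/-! ### The tree -/

/-- The parent function of the tree with a leaf for each point and an internal vertex for each
value of `π`. -/
def treeParent {Q : Type} (π : Q → Q) : Q ⊕ Set.range π → Q ⊕ Set.range π
  | Sum.inl p => Sum.inr ⟨π p, p, rfl⟩
  | Sum.inr x => Sum.inr ⟨π x, x, rfl⟩

/-- The point assigned to a vertex of the tree. -/
def treePoint {Q : Type} (π : Q → Q) : Q ⊕ Set.range π → Q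
  | Sum.inl p => p
  | Sum.inr x => x

lemma treePoint_treeParent {Q : Type} (π : Q → Q) (v : Q ⊕ Set.range π) :
    treePoint π (treeParent π v) = π (treePoint π v) := by
  cases v <;> rfl

lemma treePoint_iterate {Q : Type} (π : Q → Q) (v : Q ⊕ Set.range π) (k : ℕ) :
    treePoint π ((treeParent π)^[k] v) = π^[k] (treePoint π v) :=
  Function.Semiconj.iterate_right (treePoint_treeParent π) k v

lemma treeParent_eq_self_iff {Q : Type} (π : Q → Q) (v : Q ⊕ Set.range π) :
    treeParent π v = v ↔ v.isRight ∧ π (treePoint π v) = treePoint π v := by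
  cases v <;> simp [treeParent, treePoint, Subtype.ext_iff]

lemma forall_treeParent_iff {Q : Type} (π : Q → Q) (v : Q ⊕ Set.range π) :
    (∀ w, treeParent π w = v → w = v) ↔ v.isLeft := by
  rcases v with p | ⟨_, p, rfl⟩
  · have : ∀ w, treeParent π w ≠ Sum.inl p := by rintro (w | w) <;> simp [treeParent]
    simp [this]
  · simp only [Sum.isLeft_inr, Bool.false_eq_true, iff_false]
    intro h
    exact absurd (h (Sum.inl p) rfl) (by simp)

lemma treePoint_inj_of_isLeft {Q : Type} (π : Q → Q) {v w : Q ⊕ Set.range π} (hv : v.isLeft)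
    (hw : w.isLeft) (h : treePoint π v = treePoint π w) : v = w := by
  cases v <;> cases w <;> simp_all [treePoint]

lemma treePoint_inj_of_not_isLeft {Q : Type} (π : Q → Q) {v w : Q ⊕ Set.range π}
    (hv : ¬ v.isLeft) (hw : ¬ w.isLeft) (h : treePoint π v = treePoint π w) : v = w := by
  cases v <;> cases w <;> simp_all [treePoint, Subtype.ext_iff]

open Classical in
lemma card_children_le {Q : Type} [Fintype Q] {π : Q → Q} {C : ℕ}
    (hC : ∀ y, (Finset.univ.filter fun z => π z = y).card ≤ C) (v : Q ⊕ Set.range π) :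
    (Finset.univ.filter fun w => treeParent π w = v).card ≤ 2 * C := by
  have hmaps : ∀ w, treeParent π w = v → π (treePoint π w) = treePoint π v := fun w hw => by
    rw [← treePoint_treeParent π, hw]
  rw [← Finset.card_filter_add_card_filter_not (fun w => w.isLeft = true), two_mul]
  refine add_le_add (le_trans ?_ (hC (treePoint π v))) (le_trans ?_ (hC (treePoint π v)))
  · refine Finset.card_le_card_of_injOn (treePoint π) (fun w hw => ?_) fun w hw w' hw' => ?_
    · simp only [Finset.coe_filter, Finset.mem_filter, Finset.mem_univ, true_and,
        Set.mem_ofPred_eq] at hw ⊢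
      exact hmaps w hw.1
    · simp only [Finset.coe_filter, Finset.mem_filter, Set.mem_ofPred_eq] at hw hw'
      exact treePoint_inj_of_isLeft π hw.2 hw'.2
  · refine Finset.card_le_card_of_injOn (treePoint π) (fun w hw => ?_) fun w hw w' hw' => ?_
    · simp only [Finset.coe_filter, Finset.mem_filter, Finset.mem_univ, true_and,
        Set.mem_ofPred_eq] at hw ⊢
      exact hmaps w hw.1
    · simp only [Finset.coe_filter, Finset.mem_filter, Set.mem_ofPred_eq] at hw hw'
      exact treePoint_inj_of_not_isLeft π hw.2 hw'.2

/-- **Tree-like spanners for doubling metrics (Gottlieb–Roditty).** For every `d ≥ 1`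
and `ε ∈ (0,1)` there is a constant `C = C(d,ε) > 0` such that every finite metric
space `P` with doubling dimension at most `d` admits a `(1+ε)`-spanner `H` together
with a rooted tree on at most `2·|P|` vertices and an assignment `r` of points to
vertices such that: (i) `r` restricted to the leaves is a bijection onto `P`; (ii) the
points assigned to internal vertices are pairwise distinct; (iii) every pair `p ≠ q`
admits a `(1+ε)`-spanner path in `H` obtained by ascending from the leaf of `p` to an
ancestor, jumping, and descending to the leaf of `q`; (iv) both `H` and the tree have
maximum degree at most `C`. -/
theorem tree_like_spanners (d : ℕ) (hd : 1 ≤ d) (ε : ℝ) (hε0 : 0 < ε) (hε1 : ε < 1) :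
    ∃ C : ℝ, 0 < C ∧
      ∀ (P : Type) [MetricSpace P] [Fintype P],
        DoublingDimLE P d →
        ∃ (H : Finset (Sym2 P)) (m : ℕ) (par : Fin m → Fin m) (r : Fin m → P),
          IsGraphOn H ∧
          m ≤ 2 * Fintype.card P ∧
          IsRootedTree par ∧
          -- (i) the leaf representatives are in 1-1 correspondence with the points of P
          (∀ v w, IsLeaf par v → IsLeaf par w → r v = r w → v = w) ∧
          (∀ p : P, ∃ v, IsLeaf par v ∧ r v = p) ∧
          -- (ii) internal vertices are assigned pairwise distinct representatives
          (∀ v w, ¬ IsLeaf par v → ¬ IsLeaf par w → r v = r w → v = w) ∧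
          -- (iii) ascend–jump–descend spanner paths
          (∀ p q : P, p ≠ q →
            ∃ (u w : Fin m) (a b : ℕ), IsLeaf par u ∧ IsLeaf par w ∧
              r u = p ∧ r w = q ∧
              (List.Chain' (fun x y => s(x, y) ∈ H)
                (ascendSeq par r u a ++ (ascendSeq par r w b).reverse)) ∧
              ((((ascendSeq par r u a ++ (ascendSeq par r w b).reverse).zip
                  (ascendSeq par r u a ++ (ascendSeq par r w b).reverse).tail).map
                  fun pr => dist pr.1 pr.2).sum ≤ (1 + ε) * dist p q)) ∧
          -- (iv) bounded degrees
          (∀ p : P, (degree H p : ℝ) ≤ C) ∧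
          (∀ v : Fin m, (treeDeg par v : ℝ) ≤ C) := by
  classical
  obtain ⟨C, hC⟩ := exists_spanner d hε0 hε1
  refine ⟨2 * C + 1, by positivity, ?_⟩
  intro P _ _ hP
  rcases isEmpty_or_nonempty P with hempty | hne
  · refine ⟨∅, 0, Fin.elim0, Fin.elim0, by simp [IsGraphOn], by simp, ⟨fun v => v.elim0,
      fun v => v.elim0⟩, fun v => v.elim0, fun p => hempty.elim p, fun v => v.elim0,
      fun p => hempty.elim p, fun p => hempty.elim p, fun v => v.elim0⟩
  obtain ⟨H, π, ρ, hH, hρ, hroot, hedge, hpath, hdeg, hfib⟩ := hC P hP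
  have hfix : ∀ x, π x = x → x = ρ := by
    intro x hx
    obtain ⟨k, hk⟩ := hroot x
    exact (Function.iterate_fixed hx k).symm.trans hk
  obtain ⟨m, hm⟩ : ∃ m, Fintype.card (P ⊕ Set.range π) = m := ⟨_, rfl⟩
  let e : P ⊕ Set.range π ≃ Fin m := Fintype.equivFinOfCardEq hm
  let par : Fin m → Fin m := fun v => e (treeParent π (e.symm v))
  let r : Fin m → P := fun v => treePoint π (e.symm v)
  have hpar : ∀ v : P ⊕ Set.range π, par (e v) = e (treeParent π v) := fun v => by simp [par]
  have hiter : ∀ (k : ℕ) (v : P ⊕ Set.range π), par^[k] (e v) = e ((treeParent π)^[k] v) := by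
    intro k v
    exact ((Function.Semiconj.iterate_right (f := e) (fun v => (hpar v).symm) k) v).symm
  have hr : ∀ v : P ⊕ Set.range π, r (e v) = treePoint π v := fun v => by simp [r]
  have hleaf : ∀ v : P ⊕ Set.range π, IsLeaf par (e v) ↔ v.isLeft := by
    intro v
    rw [← forall_treeParent_iff, IsLeaf, ← e.forall_congr_right]
    simp only [hpar, e.apply_eq_iff_eq]
  have hseq : ∀ (p : P) (a : ℕ), ascendSeq par r (e (Sum.inl p)) a =
      (List.range (a + 1)).map fun i => π^[i] p := by
    intro p a
    simp only [ascendSeq, hiter, hr, treePoint_iterate]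
    rfl
  refine ⟨H, m, par, r, hH, ?_, ⟨?_, ?_⟩, ?_, ?_, ?_, ?_, ?_, ?_⟩
  · have := Fintype.card_le_of_surjective _ (Set.rangeFactorization_surjective (f := π))
    rw [← hm, Fintype.card_sum]
    omega
  · rw [e.symm.forall_congr_left]
    intro v
    rw [e.symm.forall_congr_left]
    intro w
    simp only [Equiv.symm_symm, hpar, e.apply_eq_iff_eq, treeParent_eq_self_iff]
    rintro ⟨hv, hv'⟩ ⟨hw, hw'⟩
    exact treePoint_inj_of_not_isLeft π (by simpa using hv) (by simpa using hw)
      ((hfix _ hv').trans (hfix _ hw').symm)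
  · rw [e.symm.forall_congr_left]
    intro v
    obtain ⟨k, hk⟩ := hroot (treePoint π v)
    refine ⟨k + 1, ?_⟩
    simp only [Equiv.symm_symm, hiter, hpar, e.apply_eq_iff_eq, treeParent_eq_self_iff,
      treePoint_iterate]
    rw [Function.iterate_succ_apply', Function.iterate_succ_apply', hk, hρ, hρ]
    refine ⟨?_, rfl⟩
    cases (treeParent π)^[k] v <;> rfl
  · rw [e.symm.forall_congr_left]
    intro v
    rw [e.symm.forall_congr_left]
    intro w
    simp only [Equiv.symm_symm, hleaf, hr, e.apply_eq_iff_eq]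
    exact treePoint_inj_of_isLeft π
  · intro p
    exact ⟨e (Sum.inl p), (hleaf _).2 rfl, hr _⟩
  · rw [e.symm.forall_congr_left]
    intro v
    rw [e.symm.forall_congr_left]
    intro w
    simp only [Equiv.symm_symm, hleaf, hr, e.apply_eq_iff_eq]
    exact treePoint_inj_of_not_isLeft π
  · intro p q hpq
    obtain ⟨x, z, W, V', hx, hz, hxz, hle⟩ := hpath p q hpq
    obtain ⟨a, b, hchain, hweight⟩ := hx.exists_path_list hedge hz hxz
    refine ⟨e (Sum.inl p), e (Sum.inl q), a, b, (hleaf _).2 rfl, (hleaf _).2 rfl, hr _, hr _,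
      ?_, ?_⟩
    · rw [hseq, hseq]
      exact hchain
    · rw [hseq, hseq]
      exact hweight.trans_le hle
  · intro p
    have : (degree H p : ℝ) ≤ C := by exact_mod_cast hdeg p
    linarith [Nat.cast_nonneg (α := ℝ) C]
  · rw [e.symm.forall_congr_left]
    intro v
    rw [Equiv.symm_symm]
    have hcard : (Finset.univ.filter fun w => par w = e v ∧ w ≠ e v).card ≤ 2 * C := by
      refine le_trans (Finset.card_le_card_of_injOn e.symm (fun w hw => ?_)
        e.symm.injective.injOn) (card_children_le hfib v)
      simp only [Finset.coe_filter, Finset.mem_univ, true_and, Set.mem_ofPred_eq] at hw ⊢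
      exact e.injective hw.1
    have hite : (if par (e v) ≠ e v then 1 else 0) ≤ 1 := by split_ifs <;> simp
    have : treeDeg par (e v) ≤ 2 * C + 1 := by
      unfold treeDeg
      omega
    exact_mod_cast this

end Stmt7
end

section
/- Let f : [0,∞) → [0,∞) be a monotone nondecreasing convex function with f(0) = 0, let n ≥ 2 and c ≥ 1 be reals, let ρ ≥ 2 be a real, let ℓ = ⌈log_ρ n⌉, and for each integer j with 1 ≤ j ≤ ℓ let n'_j be a real with 0 ≤ n'_j ≤ min{n, c·n/ρ^{j−1}}. Then Σ_{j=1}^{ℓ} f(n'_j) ≤ (log_ρ c + 1 + ρ/(ρ−1))·f(n). -/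
open scoped BigOperators

namespace Stmt9

/-- A geometric sequence of ratio `1/ρ` starting at most at `ρ ^ m` and truncated at `1` sums to
at most `m + ρ / (ρ - 1)`. -/
theorem sum_min_one_div_pow_le {ρ : ℝ} (hρ : 1 < ρ) (m L : ℕ) {c : ℝ} (hc : c ≤ ρ ^ m) :
    ∑ i ∈ Finset.range L, min 1 (c / ρ ^ i) ≤ m + ρ / (ρ - 1) := by
  have hρ0 : 0 < ρ := by linarith
  have hρ1 : 0 < ρ - 1 := by linarith
  induction m generalizing c L with
  | zero =>
    have hinv : ρ⁻¹ < 1 := inv_lt_one_of_one_lt₀ hρ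
    calc ∑ i ∈ Finset.range L, min 1 (c / ρ ^ i)
        ≤ ∑ i ∈ Finset.range L, ρ⁻¹ ^ i := by
          refine Finset.sum_le_sum fun i _ => (min_le_right _ _).trans ?_
          rw [inv_pow, ← one_div]
          gcongr
          simpa using hc
      _ ≤ ∑' i : ℕ, ρ⁻¹ ^ i :=
          (summable_geometric_of_lt_one (by positivity) hinv).sum_le_tsum _
            fun i _ => by positivity
      _ = (0 : ℕ) + ρ / (ρ - 1) := by
          rw [tsum_geometric_of_lt_one (by positivity) hinv]
          have : 1 - ρ⁻¹ = (ρ - 1) / ρ := by field_simp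
          rw [this, inv_div]
          simp
  | succ m ih =>
    cases L with
    | zero => simp only [Finset.range_zero, Finset.sum_empty]; positivity
    | succ L =>
      have htail := ih L (c := c / ρ) (by rwa [div_le_iff₀ hρ0, ← pow_succ])
      simp only [div_div, ← pow_succ'] at htail
      rw [Finset.sum_range_succ']
      have hhead : min 1 (c / ρ ^ 0) ≤ 1 := min_le_left _ _
      push_cast
      linarith

/-- For a monotone nondecreasing convex function `f : [0,∞) → [0,∞)` with `f(0) = 0`,
reals `n ≥ 2`, `c ≥ 1`, `ρ ≥ 2`, `ℓ = ⌈log_ρ n⌉`, and reals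
`0 ≤ n'_j ≤ min {n, c·n/ρ^{j-1}}` for `1 ≤ j ≤ ℓ`, one has
`Σ_{j=1}^{ℓ} f(n'_j) ≤ (log_ρ c + 1 + ρ/(ρ-1))·f(n)`. -/
theorem convex_geometric_sum (f : ℝ → ℝ)
    (hmono : MonotoneOn f (Set.Ici 0))
    (hconv : ConvexOn ℝ (Set.Ici 0) f)
    (hf0 : f 0 = 0)
    (hnonneg : ∀ x ∈ Set.Ici (0 : ℝ), 0 ≤ f x)
    (n c ρ : ℝ) (hn : 2 ≤ n) (hc : 1 ≤ c) (hρ : 2 ≤ ρ)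
    (ℓ : ℕ) (hℓ : ℓ = ⌈Real.logb ρ n⌉₊)
    (n' : ℕ → ℝ)
    (hn'0 : ∀ j ∈ Finset.Icc 1 ℓ, 0 ≤ n' j)
    (hn' : ∀ j ∈ Finset.Icc 1 ℓ, n' j ≤ min n (c * n / ρ ^ (j - 1))) :
    ∑ j ∈ Finset.Icc 1 ℓ, f (n' j) ≤ (Real.logb ρ c + 1 + ρ / (ρ - 1)) * f n := by
  have hn0 : 0 < n := by linarith
  have hfn : 0 ≤ f n := hnonneg n hn0.le
  have hterm : ∀ j ∈ Finset.Icc 1 ℓ, f (n' j) ≤ min 1 (c / ρ ^ (j - 1)) * f n := by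
    intro j hj
    have hx0 := hn'0 j hj
    obtain ⟨hxn, hxc⟩ := le_min_iff.mp (hn' j hj)
    have hx1 : n' j / n ≤ 1 := (div_le_one hn0).mpr hxn
    have hstar : f (n' j) ≤ n' j / n * f n := by
      have h := hconv.2 (Set.mem_Ici.mpr hn0.le) (Set.mem_Ici.mpr le_rfl)
        (div_nonneg hx0 hn0.le) (sub_nonneg.mpr hx1) (by ring)
      simpa [hf0, div_mul_cancel₀ _ hn0.ne'] using h
    refine hstar.trans (mul_le_mul_of_nonneg_right (le_min hx1 ?_) hfn)
    rw [div_le_iff₀ hn0]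
    exact hxc.trans_eq (by ring)
  have hlogc : 0 ≤ Real.logb ρ c := Real.logb_nonneg (by linarith) hc
  have hcpow : c ≤ ρ ^ ⌈Real.logb ρ c⌉₊ := by
    rw [← Real.rpow_natCast, ← Real.logb_le_iff_le_rpow (by linarith) (by linarith)]
    exact Nat.le_ceil _
  calc ∑ j ∈ Finset.Icc 1 ℓ, f (n' j)
      ≤ ∑ j ∈ Finset.Icc 1 ℓ, min 1 (c / ρ ^ (j - 1)) * f n := Finset.sum_le_sum hterm
    _ = (∑ i ∈ Finset.range ℓ, min 1 (c / ρ ^ i)) * f n := by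
        rw [← Finset.sum_mul, Finset.range_eq_Ico, ← Finset.Ico_add_one_right_eq_Icc,
          Finset.sum_Ico_eq_sum_range, Finset.range_eq_Ico]
        simp
    _ ≤ (Real.logb ρ c + 1 + ρ / (ρ - 1)) * f n := by
        refine mul_le_mul_of_nonneg_right ?_ hfn
        have h := sum_min_one_div_pow_le (by linarith) _ ℓ hcpow
        have hceil := Nat.ceil_lt_add_one hlogc
        linarith

end Stmt9
end

section
/- Let f : [0,∞) → [0,∞) be a monotone nondecreasing convex function with f(0) = 0, let n ≥ 2, c ≥ 1, ρ ≥ 2, L > 0, and t ≥ 1 be reals, let ℓ = ⌈log_ρ n⌉, let τ_j = 2·(L/n)·t·(1 + 1/c)·ρ^j for each integer j with 1 ≤ j ≤ ℓ, and for each such j let n'_j be a real with 0 ≤ n'_j ≤ min{n, c·n/ρ^{j−1}}. Then Σ_{j=1}^{ℓ} f(n'_j)·τ_j ≤ 2·(c+1)·t·ρ·ℓ·(f(n)/n)·L. -/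
open scoped BigOperators

namespace Stmt10

/-- A convex function on `[0,∞)` vanishing at `0` lies below its chord from `0` to `n`. -/
theorem convexOn_le_div_mul {f : ℝ → ℝ} (hconv : ConvexOn ℝ (Set.Ici 0) f) (hf0 : f 0 = 0)
    {x n : ℝ} (hn : 0 < n) (hx : 0 ≤ x) (hxn : x ≤ n) : f x ≤ x / n * f n := by
  have h := hconv.2 (Set.mem_Ici.2 hn.le) (Set.mem_Ici.2 le_rfl) (div_nonneg hx hn.le)
    (sub_nonneg.2 ((div_le_one hn).2 hxn)) (add_sub_cancel (x / n) 1)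
  simpa [hf0, div_mul_cancel₀ x hn.ne'] using h

/-- For a monotone nondecreasing convex function `f : [0,∞) → [0,∞)` with `f(0) = 0`,
reals `n ≥ 2`, `c ≥ 1`, `ρ ≥ 2`, `L > 0`, `t ≥ 1`, `ℓ = ⌈log_ρ n⌉`, thresholds
`τ_j = 2·(L/n)·t·(1 + 1/c)·ρ^j`, and reals `0 ≤ n'_j ≤ min {n, c·n/ρ^{j-1}}` for
`1 ≤ j ≤ ℓ`, one has `Σ_{j=1}^{ℓ} f(n'_j)·τ_j ≤ 2·(c+1)·t·ρ·ℓ·(f(n)/n)·L`. -/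
theorem convex_weighted_geometric_sum (f : ℝ → ℝ)
    (hmono : MonotoneOn f (Set.Ici 0))
    (hconv : ConvexOn ℝ (Set.Ici 0) f)
    (hf0 : f 0 = 0)
    (hnonneg : ∀ x ∈ Set.Ici (0 : ℝ), 0 ≤ f x)
    (n c ρ L t : ℝ) (hn : 2 ≤ n) (hc : 1 ≤ c) (hρ : 2 ≤ ρ) (hL : 0 < L) (ht : 1 ≤ t)
    (ℓ : ℕ) (hℓ : ℓ = ⌈Real.logb ρ n⌉₊)
    (τ : ℕ → ℝ)
    (hτ : ∀ j ∈ Finset.Icc 1 ℓ, τ j = 2 * (L / n) * t * (1 + 1 / c) * ρ ^ j)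
    (n' : ℕ → ℝ)
    (hn'0 : ∀ j ∈ Finset.Icc 1 ℓ, 0 ≤ n' j)
    (hn' : ∀ j ∈ Finset.Icc 1 ℓ, n' j ≤ min n (c * n / ρ ^ (j - 1))) :
    ∑ j ∈ Finset.Icc 1 ℓ, f (n' j) * τ j ≤
      2 * (c + 1) * t * ρ * (ℓ : ℝ) * (f n / n) * L := by
  have hn0 : 0 < n := by linarith
  have hc0 : 0 < c := by linarith
  have hρ0 : 0 < ρ := by linarith
  have hfn : 0 ≤ f n := hnonneg n hn0.le
  have term_le : ∀ j ∈ Finset.Icc 1 ℓ,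
      f (n' j) * τ j ≤ 2 * (c + 1) * t * ρ * (f n / n) * L := by
    intro j hj
    have hτj : 0 ≤ τ j := by rw [hτ j hj]; positivity
    have hratio : n' j / n ≤ c / ρ ^ (j - 1) := by
      rw [div_le_iff₀ hn0, div_mul_eq_mul_div]
      exact (hn' j hj).trans (min_le_right _ _)
    have hpow : ρ ^ j = ρ ^ (j - 1) * ρ :=
      (pow_sub_one_mul (Nat.one_le_iff_ne_zero.1 (Finset.mem_Icc.1 hj).1) ρ).symm
    calc f (n' j) * τ j
        ≤ n' j / n * f n * τ j := by
          gcongr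
          exact convexOn_le_div_mul hconv hf0 hn0 (hn'0 j hj)
            ((hn' j hj).trans (min_le_left _ _))
      _ ≤ c / ρ ^ (j - 1) * f n * τ j := by gcongr
      _ = 2 * (c + 1) * t * ρ * (f n / n) * L := by
          rw [hτ j hj, hpow]
          field_simp
  calc ∑ j ∈ Finset.Icc 1 ℓ, f (n' j) * τ j
      ≤ (Finset.Icc 1 ℓ).card • (2 * (c + 1) * t * ρ * (f n / n) * L) :=
        Finset.sum_le_card_nsmul _ _ _ term_le
    _ = 2 * (c + 1) * t * ρ * (ℓ : ℝ) * (f n / n) * L := by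
        rw [Nat.card_Icc, Nat.add_sub_cancel, nsmul_eq_mul]
        ring

end Stmt10
end

section
/- Let G = (V, E) be a finite simple graph and let R ⊆ V be an arbitrary subset of its vertices. Then there exists a subgraph Γ of G that is a vertex-disjoint union of stars such that: (1) every vertex of R that is not isolated in G belongs to the vertex set of some star of Γ; and (2) each star of Γ consists of one center s ∈ V and k ≥ 1 leaves z_1, …, z_k all belonging to R, its edge set being {(z_i, s) : 1 ≤ i ≤ k}, with all these edges being edges of G. -/
namespace Stmt11

/-- A finite set `L ⊆ R` of leaves with a parent map `p` along edges of `G`, such that every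
non-isolated vertex of `R` is a leaf or a parent of a leaf. -/
def IsParentCover {V : Type*} (G : SimpleGraph V) (R : Set V) (L : Finset V) (p : V → V) : Prop :=
  (∀ z ∈ L, z ∈ R ∧ G.Adj z (p z)) ∧
    ∀ v ∈ R, (∃ u, G.Adj v u) → v ∈ L ∨ ∃ z ∈ L, p z = v

/-- If the parent `p z` of a leaf `z` is itself a leaf, then the cover can be modified so as to
have fewer leaves and parents in total. -/
lemma IsParentCover.exists_lt {V : Type*} [DecidableEq V] {G : SimpleGraph V} {R : Set V}
    {L : Finset V} {p : V → V} (h : IsParentCover G R L p) {z : V} (hz : z ∈ L) (hw : p z ∈ L) :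
    ∃ L' p', IsParentCover G R L' p' ∧
      L'.card + (L'.image p').card < L.card + (L.image p).card := by
  obtain ⟨hL, hcov⟩ := h
  have hne : z ≠ p z := (hL z hz).2.ne
  obtain ⟨w, hpz⟩ : ∃ w, p z = w := ⟨_, rfl⟩
  rw [hpz] at hw hne
  have hwx : G.Adj w (p w) := (hL w hw).2
  have hcard : (L.erase w).card + 1 = L.card := Finset.card_erase_add_one hw
  by_cases hx : p w ∈ R ∧ p w ∉ L ∧ ∀ y ∈ L, p y = p w → y = w
  · obtain ⟨hxR, hxL, hxu⟩ := hx
    refine ⟨insert (p w) (L.erase w), Function.update p (p w) w, ⟨?_, ?_⟩, ?_⟩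
    · intro y hy
      by_cases hyx : y = p w
      · subst hyx
        simpa using ⟨hxR, hwx.symm⟩
      · simp only [Finset.mem_insert, hyx, Finset.mem_erase, false_or] at hy
        simpa [Function.update_of_ne hyx] using hL y hy.2
    · intro v hv hu
      by_cases hvw : v = w
      · exact .inr ⟨p w, by simp, by simp [hvw]⟩
      by_cases hvx : v = p w
      · exact .inl (by simp [hvx])
      rcases hcov v hv hu with hvL | ⟨y, hy, rfl⟩
      · exact .inl (by simp [hvw, hvL])
      · have hyx : y ≠ p w := fun e => hxL (e ▸ hy)
        have hyw : y ≠ w := fun e => hvx (e ▸ rfl)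
        exact .inr ⟨y, by simp [hyw, hy], Function.update_of_ne hyx _ _⟩
    · have hsub : (insert (p w) (L.erase w)).image (Function.update p (p w) w) ⊆
          (L.image p).erase (p w) := by
        intro v hv
        obtain ⟨y, hy, rfl⟩ := Finset.mem_image.mp hv
        by_cases hyx : y = p w
        · subst hyx
          simpa using ⟨hwx.ne, z, hz, hpz⟩
        · simp only [Finset.mem_insert, hyx, Finset.mem_erase, false_or] at hy
          rw [Function.update_of_ne hyx]
          exact Finset.mem_erase.mpr
            ⟨fun e => hy.1 (hxu y hy.2 e), Finset.mem_image_of_mem p hy.2⟩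
      have h1 := Finset.card_le_card hsub
      have h2 := Finset.card_erase_add_one (Finset.mem_image_of_mem p hw)
      have h3 := Finset.card_insert_le (p w) (L.erase w)
      omega
  · refine ⟨L.erase w, p, ⟨fun y hy => hL y (Finset.mem_of_mem_erase hy), ?_⟩, ?_⟩
    · intro v hv hu
      by_cases hvw : v = w
      · exact .inr ⟨z, by simp [hne, hz], hpz.trans hvw.symm⟩
      rcases hcov v hv hu with hvL | ⟨y, hy, rfl⟩
      · exact .inl (by simp [hvw, hvL])
      · by_cases hyw : y = w
        · subst hyw
          by_cases hyL : p y ∈ L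
          · exact .inl (by simp [hvw, hyL])
          · push Not at hx
            obtain ⟨t, ht, hty, htne⟩ := hx hv hyL
            exact .inr ⟨t, by simp [htne, ht], hty⟩
        · exact .inr ⟨y, by simp [hyw, hy], rfl⟩
    · have := Finset.card_le_card (Finset.image_subset_image (f := p) (Finset.erase_subset w L))
      omega

/-- Every parent cover can be turned into one in which no parent of a leaf is a leaf. -/
lemma IsParentCover.exists_parent_notMem {V : Type*} [DecidableEq V] {G : SimpleGraph V}
    {R : Set V} {L : Finset V} {p : V → V} (h : IsParentCover G R L p) :
    ∃ L' p', IsParentCover G R L' p' ∧ ∀ z ∈ L', p' z ∉ L' := by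
  induction hn : L.card + (L.image p).card using Nat.strong_induction_on generalizing L p with
  | _ n ih =>
    by_cases hgood : ∀ z ∈ L, p z ∉ L
    · exact ⟨L, p, h, hgood⟩
    · push Not at hgood
      obtain ⟨z, hz, hw⟩ := hgood
      obtain ⟨L', p', h', hlt⟩ := h.exists_lt hz hw
      exact ih _ (hn ▸ hlt) h' rfl

/-- In a finite graph, sending each non-isolated vertex of `R` to some neighbour is a parent
cover. -/
lemma exists_isParentCover {V : Type*} [Fintype V] (G : SimpleGraph V) (R : Set V) :
    ∃ L p, IsParentCover G R L p := by
  classical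
  have hp : ∀ v, ∃ u, (∃ u, G.Adj v u) → G.Adj v u := fun v => by
    by_cases hv : ∃ u, G.Adj v u
    · exact hv.imp fun _ hu _ => hu
    · exact ⟨v, fun h => absurd h hv⟩
  choose p hp using hp
  refine ⟨Finset.univ.filter fun v => v ∈ R ∧ ∃ u, G.Adj v u, p, ?_, ?_⟩
  · intro z hz
    simp only [Finset.mem_filter, Finset.mem_univ, true_and] at hz
    exact ⟨hz.1, hp z hz.2⟩
  · exact fun v hv hu => .inl (by simpa using ⟨hv, hu⟩)

/-- **Procedure `Attach` (star forest covering).** Let `G` be a finite simple graph on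
the vertex set `V`, and let `R ⊆ V` be an arbitrary subset of its vertices. Then there
is a vertex-disjoint collection `Γ` of stars, each star consisting of a center `s ∈ V`
and `k ≥ 1` leaves `z₁, …, z_k ∈ R` joined to `s` by edges of `G`, such that every
vertex of `R` which is not isolated in `G` belongs to some star of `Γ`. A star is
encoded as a pair `(s, Z)` of its center `s` and its (nonempty) leaf set `Z`. -/
theorem star_forest_covering {V : Type} [Fintype V] [DecidableEq V]
    (G : SimpleGraph V) (R : Set V) :
    ∃ Γ : Finset (V × Finset V),
      -- each element of Γ is a star: a center with a nonempty set of leaves, all the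
      -- leaves lying in R, each leaf joined to the center by an edge of G
      (∀ S ∈ Γ, S.2.Nonempty ∧ S.1 ∉ S.2 ∧ (↑S.2 : Set V) ⊆ R ∧
        ∀ z ∈ S.2, G.Adj z S.1) ∧
      -- the stars are vertex-disjoint
      (∀ S ∈ Γ, ∀ S' ∈ Γ, S ≠ S' → Disjoint (insert S.1 S.2) (insert S'.1 S'.2)) ∧
      -- every non-isolated vertex of R is covered
      (∀ v ∈ R, (∃ u, G.Adj v u) → ∃ S ∈ Γ, v ∈ insert S.1 S.2) := by
  obtain ⟨L₀, p₀, h₀⟩ := exists_isParentCover G R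
  obtain ⟨L, p, ⟨hL, hcov⟩, hgood⟩ := h₀.exists_parent_notMem
  refine ⟨(L.image p).image fun s => (s, L.filter fun z => p z = s), ?_, ?_, ?_⟩
  · intro S hS
    simp only [Finset.mem_image, exists_exists_and_eq_and] at hS
    obtain ⟨z, hz, rfl⟩ := hS
    refine ⟨⟨z, by simp [hz]⟩, by simp [hgood z hz], ?_, ?_⟩
    · intro y hy
      simp only [Finset.coe_filter, Set.mem_ofPred_eq] at hy
      exact (hL y hy.1).1
    · intro y hy
      simp only [Finset.mem_filter] at hy
      exact hy.2 ▸ (hL y hy.1).2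
  · intro S hS S' hS' hne
    simp only [Finset.mem_image, exists_exists_and_eq_and] at hS hS'
    obtain ⟨z, hz, rfl⟩ := hS
    obtain ⟨z', hz', rfl⟩ := hS'
    have hpne : p z ≠ p z' := fun e => hne (by rw [e])
    rw [Finset.disjoint_left]
    intro v hv hv'
    simp only [Finset.mem_insert, Finset.mem_filter] at hv hv'
    rcases hv with rfl | ⟨hvL, hv⟩ <;> rcases hv' with hv' | ⟨hvL', hv'⟩
    · exact hpne hv'
    · exact hgood z hz hvL'
    · exact hgood z' hz' (hv' ▸ hvL)
    · exact hpne (hv.symm.trans hv')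
  · intro v hv hu
    simp only [Finset.mem_image, exists_exists_and_eq_and, Finset.mem_insert]
    rcases hcov v hv hu with hvL | ⟨z, hz, rfl⟩
    · exact ⟨v, hvL, .inr (by simp [hvL])⟩
    · exact ⟨z, hz, .inl rfl⟩

end Stmt11
end
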